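/- Let B = (β₀, β₁) be a rank Betti table with nonnegative values satisfying the rank equation and the antichain inequality for every order ideal of Y±, and suppose that for some order ideal I the antichain inequality is an equality: ∑_{λ∈I°} β₀(λ) = ∑_{λ∈I} β₁(λ). Define B_I = (β₀·𝟙_{I°}, β₁·𝟙_I) (the restriction of β₀ to I° and of β₁ to I, extended by zero) and B_rest = B − B_I. Then both B_I and B_rest have nonnegative values and satisfy the rank equation and the antichain inequality for every order ideal of Y±. -/

import Mathlib

/-- The extended Young's lattice `Y±`: weakly decreasing integer sequences of
length `k`, i.e. antitone functions `Fin k → ℤ`, ordered pointwise. -/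
abbrev YL (k : ℕ) : Type := {f : Fin k → ℤ // Antitone f}

/-- A rank Betti table: a pair of finitely supported functions `Y± → ℚ`. -/
abbrev Table (k : ℕ) : Type := (YL k →₀ ℚ) × (YL k →₀ ℚ)

/-- An order ideal: a downward-closed subset of `Y±`. -/
def IsOrderIdeal {k : ℕ} (I : Set (YL k)) : Prop :=
  ∀ ⦃x⦄, x ∈ I → ∀ ⦃y⦄, y ≤ x → y ∈ I

/-- The interior `I° = {λ : λ < μ for some μ ∈ I}` of a subset of `Y±`. -/
def idealInterior {k : ℕ} (I : Set (YL k)) : Set (YL k) :=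
  {x | ∃ y ∈ I, x < y}

/-- The sum of a finitely supported function over a subset of `Y±`. -/
noncomputable def sumOn {k : ℕ} {M : Type*} [AddCommMonoid M]
    (β : YL k →₀ M) (S : Set (YL k)) : M :=
  ∑ x ∈ β.support, Set.indicator S (⇑β) x

/-- The total sum `∑_λ β(λ)` of a finitely supported function on `Y±`. -/
def total {k : ℕ} {M : Type*} [AddCommMonoid M] (β : YL k →₀ M) : M :=
  ∑ x ∈ β.support, β x

/-- The pure table `P(λ, μ)`: `β₀` is the indicator of `λ` and `β₁` is the
indicator of `μ`. -/
noncomputable def pureTable {k : ℕ} (lam mu : YL k) : Table k :=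
  (Finsupp.single lam 1, Finsupp.single mu 1)

/-- Membership in the Boij–Söderberg cone cut out by nonnegativity, the rank
equation, and the antichain inequalities. -/
def InCone {k : ℕ} (B : Table k) : Prop :=
  (∀ x, 0 ≤ B.1 x) ∧ (∀ x, 0 ≤ B.2 x) ∧
  total B.1 = total B.2 ∧
  ∀ I : Set (YL k), IsOrderIdeal I → sumOn B.2 I ≤ sumOn B.1 (idealInterior I)

open Classical in
/-- The restriction `β·𝟙_S` of a finitely supported function to a set `S`,
extended by zero. -/
noncomputable def restrictTo {k : ℕ} (β : YL k →₀ ℚ) (S : Set (YL k)) : YL k →₀ ℚ :=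
  Finsupp.filter (· ∈ S) β

theorem sumOn_eq_sum_of_support_subset {k : ℕ} (β : YL k →₀ ℚ) (S : Set (YL k))
    {s : Finset (YL k)} (hs : β.support ⊆ s) :
    sumOn β S = ∑ x ∈ s, S.indicator β x := by
  refine Finset.sum_subset hs fun x _ hx => ?_
  rw [Set.indicator_apply_eq_zero]
  exact fun _ => Finsupp.notMem_support_iff.mp hx

theorem total_eq_sumOn_univ {k : ℕ} (β : YL k →₀ ℚ) : total β = sumOn β Set.univ := by
  simp [total, sumOn]

theorem restrictTo_apply {k : ℕ} (β : YL k →₀ ℚ) (S : Set (YL k)) (x : YL k) :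
    restrictTo β S x = S.indicator β x := by
  classical
  simp only [restrictTo, Finsupp.filter_apply, Set.indicator_apply]

theorem sumOn_restrictTo {k : ℕ} (β : YL k →₀ ℚ) (S T : Set (YL k)) :
    sumOn (restrictTo β S) T = sumOn β (S ∩ T) := by
  classical
  rw [sumOn_eq_sum_of_support_subset (restrictTo β S) T (s := β.support)
    (by simp only [restrictTo, Finsupp.support_filter, Finset.filter_subset]), sumOn]
  refine Finset.sum_congr rfl fun x _ => ?_
  rw [Set.inter_comm, ← Set.indicator_indicator, funext (restrictTo_apply β S)]

theorem sumOn_sub {k : ℕ} (β γ : YL k →₀ ℚ) (S : Set (YL k)) :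
    sumOn (β - γ) S = sumOn β S - sumOn γ S := by
  classical
  rw [sumOn_eq_sum_of_support_subset (β - γ) S Finsupp.support_sub,
    sumOn_eq_sum_of_support_subset β S Finset.subset_union_left,
    sumOn_eq_sum_of_support_subset γ S Finset.subset_union_right,
    ← Finset.sum_sub_distrib, Finsupp.coe_sub, Set.indicator_sub']
  rfl

theorem sumOn_union_add_inter {k : ℕ} (β : YL k →₀ ℚ) (S T : Set (YL k)) :
    sumOn β (S ∪ T) + sumOn β (S ∩ T) = sumOn β S + sumOn β T := by
  simp only [sumOn, ← Finset.sum_add_distrib, Set.indicator_union_add_inter_apply]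

theorem sumOn_mono {k : ℕ} {β : YL k →₀ ℚ} (hβ : ∀ x, 0 ≤ β x) {S T : Set (YL k)}
    (h : S ⊆ T) : sumOn β S ≤ sumOn β T :=
  Finset.sum_le_sum fun x _ => Set.indicator_le_indicator_of_subset h hβ x

theorem IsOrderIdeal.inter {k : ℕ} {I J : Set (YL k)} (hI : IsOrderIdeal I)
    (hJ : IsOrderIdeal J) : IsOrderIdeal (I ∩ J) :=
  fun _ hx _ h => ⟨hI hx.1 h, hJ hx.2 h⟩

theorem IsOrderIdeal.union {k : ℕ} {I J : Set (YL k)} (hI : IsOrderIdeal I)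
    (hJ : IsOrderIdeal J) : IsOrderIdeal (I ∪ J) :=
  fun _ hx _ h => hx.imp (fun hx => hI hx h) (fun hx => hJ hx h)

theorem idealInterior_mono {k : ℕ} {I J : Set (YL k)} (h : I ⊆ J) :
    idealInterior I ⊆ idealInterior J :=
  fun _ ⟨y, hy, hxy⟩ => ⟨y, h hy, hxy⟩

theorem idealInterior_union {k : ℕ} (I J : Set (YL k)) :
    idealInterior (I ∪ J) = idealInterior I ∪ idealInterior J := by
  ext x
  simp only [idealInterior, Set.mem_union, Set.mem_ofPred_eq, or_and_right, exists_or]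

theorem restrictTo_nonneg {k : ℕ} {β : YL k →₀ ℚ} (hβ : ∀ x, 0 ≤ β x) (S : Set (YL k))
    (x : YL k) : 0 ≤ restrictTo β S x := by
  rw [restrictTo_apply]
  exact Set.indicator_nonneg (fun x _ => hβ x) x

theorem sub_restrictTo_nonneg {k : ℕ} {β : YL k →₀ ℚ} (hβ : ∀ x, 0 ≤ β x) (S : Set (YL k))
    (x : YL k) : 0 ≤ (β - restrictTo β S) x := by
  rw [Finsupp.sub_apply, restrictTo_apply, sub_nonneg]
  exact Set.indicator_le_self' (fun x _ => hβ x) x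

/-- If a table in the cone achieves equality in the antichain inequality for an
order ideal `I`, then it splits as `B = B_I + B_rest` with
`B_I = (β₀·𝟙_{I°}, β₁·𝟙_I)`, and both summands lie in the cone. -/
theorem equality_case_split (k : ℕ) (hk : 0 < k) (β₀ β₁ : YL k →₀ ℚ)
    (hB : InCone (β₀, β₁)) (I : Set (YL k)) (hI : IsOrderIdeal I)
    (heq : sumOn β₀ (idealInterior I) = sumOn β₁ I) :
    InCone (restrictTo β₀ (idealInterior I), restrictTo β₁ I) ∧
    InCone (β₀ - restrictTo β₀ (idealInterior I), β₁ - restrictTo β₁ I) := by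
  obtain ⟨h₀, h₁, htot, hanti⟩ := hB
  dsimp only at h₀ h₁ htot hanti
  rw [total_eq_sumOn_univ, total_eq_sumOn_univ] at htot
  refine ⟨⟨restrictTo_nonneg h₀ _, restrictTo_nonneg h₁ _, ?_, fun J hJ => ?_⟩,
    sub_restrictTo_nonneg h₀ _, sub_restrictTo_nonneg h₁ _, ?_, fun J hJ => ?_⟩ <;>
    simp only [total_eq_sumOn_univ, sumOn_sub, sumOn_restrictTo, Set.inter_univ]
  · exact heq
  · exact (hanti _ (hI.inter hJ)).trans <| sumOn_mono h₀ <| Set.subset_inter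
      (idealInterior_mono Set.inter_subset_left) (idealInterior_mono Set.inter_subset_right)
  · rw [htot, heq]
  · have hunion := hanti _ (hI.union hJ)
    rw [idealInterior_union] at hunion
    linarith [sumOn_union_add_inter β₁ I J,
      sumOn_union_add_inter β₀ (idealInterior I) (idealInterior J)]
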